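/- Let d = 10 and n_t = 1 (η(0) = −1 and η(a) = +1 for a ≠ 0), and let Γ_a be a gamma-matrix representation with chirality matrix Γ^{(11)} := (−i)^6 · (1/10!) · Σ ε_{μ₁…μ₁₀} Γ^{μ₁}⋯Γ^{μ₁₀}. Let 1 ≤ n ≤ 9, let G be an alternating n-tensor and H an alternating (10−n)-tensor on ℝ^{10} related by the duality constraint ⋆G = (−1)^{n(n−1)/2} H. Then (1/n!) · Σ_{a : Fin n → Fin 10} G(a) · Γ^{a₁}⋯Γ^{aₙ} · Γ^{(11)} = −(1/(10−n)!) · Σ_{b : Fin (10−n) → Fin 10} H(b) · Γ^{b₁}⋯Γ^{b_{10−n}}, where all gamma indices are raised with η. (Corollary of Appendix C: (1/n!) ⧸G_{(n)} Γ^{(11)} = −(1/(10−n)!) ⧸G_{(10−n)}.) -/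

import Mathlib

open scoped BigOperators

/-- The ordered product `Γ_{a₁} ⋯ Γ_{a_k}` of gamma matrices. -/
noncomputable def gammaProd {d N : ℕ} (Γ : Fin d → Matrix (Fin N) (Fin N) ℂ)
    {k : ℕ} (a : Fin k → Fin d) : Matrix (Fin N) (Fin N) ℂ :=
  (List.ofFn fun i => Γ (a i)).prod

/-- The flat Minkowski metric `η = diag(−1,+1,…,+1)` on `ℝ^{10}` (matrix entries);
indices are raised with `η`, whose inverse has the same entries. -/
noncomputable def etaMink : Fin 10 → Fin 10 → ℝ :=
  fun p q => if p = q then (if p = 0 then -1 else 1) else 0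

/-- The real Levi-Civita symbol on ten indices, with `ε_{01…9} = +1`. -/
noncomputable def leviR (μ : Fin 10 → Fin 10) : ℝ :=
  ∑ π : Equiv.Perm (Fin 10), if μ = ⇑π then (((Equiv.Perm.sign π : ℤ)) : ℝ) else 0

/-- Concatenation `(κ₁,…,κₙ,ν₁,…,ν_{10−n})` of index strings, as a map `Fin 10 → Fin 10`. -/
def catFn (n : ℕ) (κ : Fin n → Fin 10) (ν : Fin (10 - n) → Fin 10) : Fin 10 → Fin 10 :=
  fun j => if h : (j : ℕ) < n then κ ⟨j, h⟩
    else if h2 : (j : ℕ) - n < 10 - n then ν ⟨(j : ℕ) - n, h2⟩ else j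

/-- The Hodge dual of an alternating `n`-tensor on Minkowski `ℝ^{10}`:
`(⋆G)_{ν₁…ν_{10−n}} = (1/n!) Σ G_{μ₁…μₙ} η^{μ₁κ₁}⋯η^{μₙκₙ} ε_{κ₁…κₙν₁…ν_{10−n}}`. -/
noncomputable def hodge (n : ℕ) (G : (Fin n → Fin 10) → ℝ)
    (ν : Fin (10 - n) → Fin 10) : ℝ :=
  (n.factorial : ℝ)⁻¹ * ∑ μ : Fin n → Fin 10, ∑ κ : Fin n → Fin 10,
    G μ * (∏ i, etaMink (μ i) (κ i)) * leviR (catFn n κ ν)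

section GammaProducts

variable {d N : ℕ} {e : Fin d → Matrix (Fin N) (Fin N) ℂ}

theorem gammaProd_succ {k : ℕ} (a : Fin (k + 1) → Fin d) :
    gammaProd e a = e (a 0) * gammaProd e (fun i => a i.succ) := by
  simp [gammaProd, List.ofFn_succ]

/-- Swapping two adjacent, distinct gamma matrices changes the sign of the product. -/
theorem gammaProd_comp_adjacent_swap (hanti : ∀ a b, a ≠ b → e a * e b = -(e b * e a))
    {k : ℕ} (i : Fin k) (a : Fin (k + 1) → Fin d) (ha : a i.castSucc ≠ a i.succ) :
    gammaProd e (a ∘ Equiv.swap i.castSucc i.succ) = -gammaProd e a := by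
  induction k with
  | zero => exact i.elim0
  | succ k ih =>
    cases i using Fin.cases with
    | zero =>
      have h : ∀ j : Fin k, Equiv.swap (0 : Fin (k + 2)) 1 j.succ.succ = j.succ.succ := fun j =>
        Equiv.swap_apply_of_ne_of_ne (Fin.succ_ne_zero _)
          (fun h => Fin.succ_ne_zero j (Fin.succ_injective _ (h.trans Fin.succ_zero_eq_one.symm)))
      have ha' : a 1 ≠ a 0 := by simpa using ha.symm
      simp [gammaProd_succ, h, ← mul_assoc, hanti _ _ ha']
    | succ j =>
      have h0 : Equiv.swap j.succ.castSucc j.succ.succ 0 = 0 :=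
        Equiv.swap_apply_of_ne_of_ne (by simp [Fin.ext_iff]) (by simp [Fin.ext_iff])
      have hs : (fun l : Fin (k + 1) => (a ∘ Equiv.swap j.succ.castSucc j.succ.succ) l.succ)
          = (fun l => a l.succ) ∘ Equiv.swap j.castSucc j.succ := by
        funext l
        simp only [Function.comp_apply, ← Fin.succ_castSucc,
          (Fin.succ_injective (k + 1)).swap_apply]
      rw [gammaProd_succ, hs, ih j (fun l => a l.succ) (by simpa using ha), Function.comp_apply,
        h0, gammaProd_succ a, mul_neg]

theorem gammaProd_comp_perm (hanti : ∀ a b, a ≠ b → e a * e b = -(e b * e a))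
    {k : ℕ} (a : Fin k → Fin d) (ha : Function.Injective a) (σ : Equiv.Perm (Fin k)) :
    gammaProd e (a ∘ σ) = ((Equiv.Perm.sign σ : ℤ) : ℂ) • gammaProd e a := by
  cases k with
  | zero => simp [gammaProd, Subsingleton.elim σ 1]
  | succ k =>
    have hσ : σ ∈ Submonoid.closure
        (Set.range fun i : Fin k => Equiv.swap i.castSucc i.succ) := by
      rw [Equiv.Perm.mclosure_swap_castSucc_succ]; trivial
    induction hσ using Submonoid.closure_induction_right with
    | one => simp
    | mul_right τ _ s hs ih =>
      obtain ⟨i, rfl⟩ := hs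
      have hne : i.castSucc ≠ i.succ := Fin.castSucc_lt_succ.ne
      rw [Equiv.Perm.coe_mul, ← Function.comp_assoc, gammaProd_comp_adjacent_swap hanti, ih,
        Equiv.Perm.sign_mul, Equiv.Perm.sign_swap hne]
      · simp
      · exact fun h => hne (τ.injective (ha h))

theorem gammaProd_mul_of_notMem (hanti : ∀ a b, a ≠ b → e a * e b = -(e b * e a))
    {k : ℕ} (a : Fin k → Fin d) (b : Fin d) (hb : ∀ i, a i ≠ b) :
    gammaProd e a * e b = (-1 : ℂ) ^ k • (e b * gammaProd e a) := by
  induction k with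
  | zero => simp [gammaProd]
  | succ k ih =>
    rw [gammaProd_succ, mul_assoc, ih _ fun i => hb i.succ, mul_smul_comm, ← mul_assoc,
      hanti _ _ (hb 0), pow_succ]
    simp [mul_assoc]

theorem gammaProd_mul_self (hanti : ∀ a b, a ≠ b → e a * e b = -(e b * e a))
    (q : Fin d → ℂ) (hsq : ∀ a, e a * e a = q a • 1)
    {k : ℕ} (a : Fin k → Fin d) (ha : Function.Injective a) :
    gammaProd e a * gammaProd e a = ((-1 : ℂ) ^ (k * (k - 1) / 2) * ∏ i, q (a i)) • 1 := by
  induction k with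
  | zero => simp [gammaProd]
  | succ k ih =>
    have h := gammaProd_mul_of_notMem hanti (fun i => a i.succ) (a 0)
      fun i h => Fin.succ_ne_zero i (ha h)
    rw [gammaProd_succ, mul_assoc, ← mul_assoc (gammaProd _ _), h, smul_mul_assoc, mul_smul_comm,
      mul_assoc, ← mul_assoc (e _), ih (fun i => a i.succ) (ha.comp (Fin.succ_injective k)), hsq,
      Fin.prod_univ_succ, Nat.triangle_succ, pow_add]
    simp only [mul_smul_comm, mul_one, smul_smul]
    congr 1
    ring

end GammaProducts

theorem catFn_eq_append {n : ℕ} (hn : n ≤ 10) (κ : Fin n → Fin 10) (ν : Fin (10 - n) → Fin 10) :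
    catFn n κ ν = Fin.append κ ν ∘ Fin.cast (Nat.add_sub_of_le hn).symm := by
  funext j
  by_cases h : (j : ℕ) < n
  · have : Fin.cast (Nat.add_sub_of_le hn).symm j = Fin.castAdd (10 - n) ⟨j, h⟩ := rfl
    rw [Function.comp_apply, this, Fin.append_left]
    simp [catFn, h]
  · have h2 : (j : ℕ) - n < 10 - n := by omega
    have : Fin.cast (Nat.add_sub_of_le hn).symm j = Fin.natAdd n ⟨j - n, h2⟩ := by
      ext; simp; omega
    rw [Function.comp_apply, this, Fin.append_right]
    simp [catFn, h, h2]

theorem catFn_injective_iff {n : ℕ} (hn : n ≤ 10) (κ : Fin n → Fin 10)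
    (ν : Fin (10 - n) → Fin 10) :
    Function.Injective (catFn n κ ν) ↔
      Function.Injective κ ∧ Function.Injective ν ∧ ∀ i j, κ i ≠ ν j := by
  rw [catFn_eq_append hn, ← Fin.append_injective_iff]
  exact (finCongr (Nat.add_sub_of_le hn).symm).injective_comp _

theorem gammaProd_catFn {N n : ℕ} (hn : n ≤ 10) (e : Fin 10 → Matrix (Fin N) (Fin N) ℂ)
    (κ : Fin n → Fin 10) (ν : Fin (10 - n) → Fin 10) :
    gammaProd e (catFn n κ ν) = gammaProd e κ * gammaProd e ν := by
  rw [catFn_eq_append hn]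
  simp only [gammaProd, ← List.prod_append, ← List.ofFn_fin_append]
  congr 1
  rw [List.ofFn_congr (Nat.add_sub_of_le hn).symm]
  congr 1
  funext i
  refine Fin.addCases (fun i => ?_) (fun i => ?_) i <;> simp

theorem leviR_perm (π : Equiv.Perm (Fin 10)) : leviR π = ((Equiv.Perm.sign π : ℤ) : ℝ) := by
  simp [leviR, DFunLike.coe_fn_eq]

theorem leviR_eq_zero {μ : Fin 10 → Fin 10} (hμ : ¬ Function.Injective μ) : leviR μ = 0 :=
  Finset.sum_eq_zero fun π _ => if_neg fun h : μ = π => hμ (h ▸ π.injective)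

theorem sum_leviR_smul_gammaProd {N : ℕ} {e : Fin 10 → Matrix (Fin N) (Fin N) ℂ}
    (hanti : ∀ a b, a ≠ b → e a * e b = -(e b * e a)) :
    ∑ μ : Fin 10 → Fin 10, ((leviR μ : ℝ) : ℂ) • gammaProd e μ
      = (Nat.factorial 10 : ℂ) • gammaProd e id := by
  have h : ∀ μ : Fin 10 → Fin 10, ((leviR μ : ℝ) : ℂ) • gammaProd e μ
      = ∑ π : Equiv.Perm (Fin 10), if μ = ⇑π then gammaProd e id else 0 := by
    intro μ
    simp only [leviR, Complex.ofReal_sum, Finset.sum_smul]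
    refine Finset.sum_congr rfl fun π _ => ?_
    split_ifs with hμ
    · rw [hμ, ← Function.id_comp ⇑π, gammaProd_comp_perm hanti id Function.injective_id, smul_smul]
      rcases Int.units_eq_one_or (Equiv.Perm.sign π) with hs | hs <;> simp [hs]
    · simp
  simp only [h]
  rw [Finset.sum_comm]
  simp only [Finset.sum_ite_eq', Finset.mem_univ, if_true, Finset.sum_const, Finset.card_univ,
    Fintype.card_perm, Fintype.card_fin, Nat.cast_smul_eq_nsmul]

/-- An injective index string of length `n` has `(10 - n)!` completions to a permutation. -/
theorem card_catFn_injective {n : ℕ} (hn : n ≤ 10) {κ : Fin n → Fin 10}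
    (hκ : Function.Injective κ) [DecidablePred fun ν => Function.Injective (catFn n κ ν)] :
    (Finset.univ.filter fun ν => Function.Injective (catFn n κ ν)).card = (10 - n).factorial := by
  classical
  let f : {ν // Function.Injective (catFn n κ ν)} ≃
      (Fin (10 - n) ↪ {x // x ∉ Set.range κ}) :=
    { toFun := fun ν =>
        ⟨fun j => ⟨ν.1 j, fun ⟨i, hi⟩ => ((catFn_injective_iff hn κ ν.1).1 ν.2).2.2 i j hi⟩,
          fun j j' h => ((catFn_injective_iff hn κ ν.1).1 ν.2).2.1 (congrArg Subtype.val h)⟩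
      invFun := fun g =>
        ⟨fun j => g j, (catFn_injective_iff hn κ _).2
          ⟨hκ, Subtype.val_injective.comp g.injective, fun i j h => (g j).2 ⟨i, h⟩⟩⟩
      left_inv := fun _ => rfl
      right_inv := fun _ => rfl }
  have hc : Fintype.card {x // x ∉ Set.range κ} = 10 - n := by
    rw [Fintype.card_subtype_compl, Fintype.card_fin]
    congr 1
    exact (Set.card_range_of_injective hκ).trans (Fintype.card_fin n)
  rw [← Fintype.card_subtype, Fintype.card_congr f, Fintype.card_embedding_eq, hc,
    Fintype.card_fin, Nat.descFactorial_self]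

theorem prod_etaMink {n : ℕ} (μ κ : Fin n → Fin 10) :
    ∏ i, etaMink (μ i) (κ i) = if μ = κ then ∏ i, (if μ i = 0 then (-1 : ℝ) else 1) else 0 := by
  split_ifs with h
  · subst h; simp [etaMink]
  · obtain ⟨i, hi⟩ := Function.ne_iff.1 h
    exact Finset.prod_eq_zero (Finset.mem_univ i) (if_neg hi)

theorem hodge_eq (n : ℕ) (G : (Fin n → Fin 10) → ℝ) (ν : Fin (10 - n) → Fin 10) :
    hodge n G ν = (n.factorial : ℝ)⁻¹ * ∑ μ : Fin n → Fin 10,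
      G μ * (∏ i, (if μ i = 0 then (-1 : ℝ) else 1)) * leviR (catFn n μ ν) := by
  simp [hodge, prod_etaMink]

/-- The product of `Γ^{a₁}⋯Γ^{aₙ}` with `Γ^0⋯Γ^9`, expanded in products of the complementary
gamma matrices. -/
theorem gammaProd_mul_gammaProd_id {N n : ℕ} (hn : n ≤ 10)
    {e : Fin 10 → Matrix (Fin N) (Fin N) ℂ}
    (hanti : ∀ a b, a ≠ b → e a * e b = -(e b * e a))
    (q : Fin 10 → ℂ) (hsq : ∀ a, e a * e a = q a • 1)
    {a : Fin n → Fin 10} (ha : Function.Injective a) :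
    gammaProd e a * gammaProd e id = ((10 - n).factorial : ℂ)⁻¹ •
      ∑ ν : Fin (10 - n) → Fin 10,
        ((-1 : ℂ) ^ (n * (n - 1) / 2) * (∏ i, q (a i)) * ((leviR (catFn n a ν) : ℝ) : ℂ)) •
          gammaProd e ν := by
  classical
  have key : ∀ ν : Fin (10 - n) → Fin 10,
      ((-1 : ℂ) ^ (n * (n - 1) / 2) * (∏ i, q (a i)) * ((leviR (catFn n a ν) : ℝ) : ℂ)) •
          gammaProd e ν
        = if Function.Injective (catFn n a ν) then gammaProd e a * gammaProd e id else 0 := by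
    intro ν
    split_ifs with h
    · let π : Equiv.Perm (Fin 10) := Equiv.ofBijective _ (Finite.injective_iff_bijective.1 h)
      have hπ : catFn n a ν = ⇑π := rfl
      have h1 : gammaProd e a * gammaProd e ν
          = ((Equiv.Perm.sign π : ℤ) : ℂ) • gammaProd e id := by
        rw [← gammaProd_catFn hn, hπ, ← gammaProd_comp_perm hanti id Function.injective_id,
          Function.id_comp]
      have h2 : gammaProd e id
          = ((Equiv.Perm.sign π : ℤ) : ℂ) • (gammaProd e a * gammaProd e ν) := by
        rw [h1, smul_smul]
        rcases Int.units_eq_one_or (Equiv.Perm.sign π) with hs | hs <;> simp [hs]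
      rw [h2, mul_smul_comm, ← mul_assoc, gammaProd_mul_self hanti q hsq a ha, smul_mul_assoc,
        one_mul, smul_smul, hπ, leviR_perm, Complex.ofReal_intCast, mul_comm]
    · simp [leviR_eq_zero h]
  simp only [key]
  rw [← Finset.sum_filter, Finset.sum_const, card_catFn_injective hn ha,
    ← Nat.cast_smul_eq_nsmul ℂ, smul_smul,
    inv_mul_cancel₀ (Nat.cast_ne_zero.2 (Nat.factorial_ne_zero _)), one_smul]

/-- Corollary of Appendix C:
`(1/n!) ⧸G_{(n)} Γ^{(11)} = −(1/(10−n)!) ⧸G_{(10−n)}`.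
For `d = 10`, `n_t = 1` (`η(0) = −1`, else `+1`), a gamma representation `Γ` with raised
matrices `Γ^a = η(a)Γ_a` and chirality matrix
`Γ^{(11)} = (−i)^6 (1/10!) Σ ε_{μ₁…μ₁₀} Γ^{μ₁}⋯Γ^{μ₁₀}`, and alternating tensors `G`
(rank `n`) and `H` (rank `10−n`) with `⋆G = (−1)^{n(n−1)/2} H`, one has
`(1/n!) Σ_a G(a) Γ^{a₁}⋯Γ^{aₙ} Γ^{(11)} = −(1/(10−n)!) Σ_b H(b) Γ^{b₁}⋯Γ^{b_{10−n}}`. -/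
theorem stmt5 {N : ℕ}
    (Γ : Fin 10 → Matrix (Fin N) (Fin N) ℂ)
    (hΓ : ∀ a b, Γ a * Γ b + Γ b * Γ a
      = if a = b then ((2 : ℂ) * ((if a = 0 then (-1 : ℝ) else 1) : ℝ)) • 1 else 0)
    (Γup : Fin 10 → Matrix (Fin N) (Fin N) ℂ)
    (hΓup : ∀ a, Γup a = (((if a = 0 then (-1 : ℝ) else 1) : ℝ) : ℂ) • Γ a)
    (chir : Matrix (Fin N) (Fin N) ℂ)
    (hchir : chir = ((-Complex.I) ^ 6 * ((Nat.factorial 10 : ℂ))⁻¹) •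
      ∑ μ : Fin 10 → Fin 10, ((leviR μ : ℝ) : ℂ) • gammaProd Γup μ)
    (n : ℕ) (hn1 : 1 ≤ n) (hn9 : n ≤ 9)
    (G : (Fin n → Fin 10) → ℝ) (H : (Fin (10 - n) → Fin 10) → ℝ)
    (hG : ∀ (a : Fin n → Fin 10) (i j : Fin n), i ≠ j →
      G (a ∘ Equiv.swap i j) = - G a)
    (hH : ∀ (b : Fin (10 - n) → Fin 10) (i j : Fin (10 - n)), i ≠ j →
      H (b ∘ Equiv.swap i j) = - H b)
    (hdual : ∀ ν, hodge n G ν = (-1 : ℝ) ^ (n * (n - 1) / 2) * H ν) :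
    ((n.factorial : ℂ)⁻¹ • ∑ a : Fin n → Fin 10, ((G a : ℝ) : ℂ) • gammaProd Γup a) * chir
      = - (((10 - n).factorial : ℂ)⁻¹ •
          ∑ b : Fin (10 - n) → Fin 10, ((H b : ℝ) : ℂ) • gammaProd Γup b) := by
  have hη : ∀ a : Fin 10, ((if a = 0 then (-1 : ℝ) else 1) : ℝ) ^ 2 = 1 := fun a => by
    split_ifs <;> norm_num
  have hanti : ∀ a b, a ≠ b → Γup a * Γup b = -(Γup b * Γup a) := by
    intro a b hab
    have h := hΓ a b
    rw [if_neg hab] at h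
    rw [hΓup, hΓup, smul_mul_smul_comm, smul_mul_smul_comm, eq_neg_of_add_eq_zero_left h,
      smul_neg, mul_comm]
  have hsq : ∀ a, Γup a * Γup a = (((if a = 0 then (-1 : ℝ) else 1) : ℝ) : ℂ) • 1 := by
    intro a
    have h := hΓ a a
    rw [if_pos rfl, ← two_smul ℂ, mul_smul] at h
    rw [hΓup, smul_mul_smul_comm, smul_right_injective _ (two_ne_zero' ℂ) h, smul_smul,
      ← Complex.ofReal_mul, ← sq, hη, Complex.ofReal_one, one_mul]
  have hI : (-Complex.I) ^ 6 = -1 := by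
    rw [neg_pow, show 6 = 2 * 3 from rfl, pow_mul Complex.I, Complex.I_sq]; norm_num
  have hchir' : chir = -gammaProd Γup id := by
    rw [hchir, sum_leviR_smul_gammaProd hanti, smul_smul, mul_assoc,
      inv_mul_cancel₀ (Nat.cast_ne_zero.2 (Nat.factorial_ne_zero _)), hI]
    simp
  have hH' : ∀ ν, H ν = (-1 : ℝ) ^ (n * (n - 1) / 2) * hodge n G ν := fun ν => by
    rw [hdual, ← mul_assoc, ← mul_pow]; norm_num
  have hterm : ∀ a : Fin n → Fin 10, ((G a : ℝ) : ℂ) • (gammaProd Γup a * gammaProd Γup id)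
      = ((10 - n).factorial : ℂ)⁻¹ • ∑ ν : Fin (10 - n) → Fin 10,
        (((-1 : ℝ) ^ (n * (n - 1) / 2) * (G a * (∏ i, (if a i = 0 then (-1 : ℝ) else 1)) *
          leviR (catFn n a ν)) : ℝ) : ℂ) • gammaProd Γup ν := by
    intro a
    by_cases ha : Function.Injective a
    · rw [gammaProd_mul_gammaProd_id (by omega) hanti _ hsq ha, smul_comm, Finset.smul_sum]
      congr 1
      refine Finset.sum_congr rfl fun ν _ => ?_
      rw [smul_smul]
      congr 1
      push_cast
      ring
    · obtain ⟨i, j, hij, hne⟩ := Function.not_injective_iff.1 ha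
      have h0 : G a = 0 := by
        have h := hG a i j hne
        have hs : a ∘ Equiv.swap i j = a := by
          funext l
          rw [Function.comp_apply, Equiv.swap_apply_def]
          split_ifs with h1 h2
          · rw [h1, hij]
          · rw [h2, hij]
          · rfl
        rw [hs] at h
        linarith
      simp [h0]
  have hterm' : ∀ ν, ((H ν : ℝ) : ℂ) • gammaProd Γup ν
      = (n.factorial : ℂ)⁻¹ • ∑ a : Fin n → Fin 10,
        (((-1 : ℝ) ^ (n * (n - 1) / 2) * (G a * (∏ i, (if a i = 0 then (-1 : ℝ) else 1)) *
          leviR (catFn n a ν)) : ℝ) : ℂ) • gammaProd Γup ν := by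
    intro ν
    rw [hH', hodge_eq, ← Finset.sum_smul, smul_smul, ← Complex.ofReal_sum, ← Finset.mul_sum]
    congr 1
    push_cast
    ring
  simp only [hchir', mul_neg, smul_mul_assoc, Finset.sum_mul, hterm, hterm']
  rw [← Finset.smul_sum, ← Finset.smul_sum, Finset.sum_comm, smul_comm]
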